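/- arXiv:1605.02286 — 5 statements merged into one kernel-verified Lean document; each statement's English description precedes it below -/
import Mathlib

section
/- Let V and W be real vector spaces, let J₁ : V → V be linear with J₁∘J₁ = -id, let g be a symmetric bilinear form on V with g(J₁X,J₁Y) = g(X,Y) for all X,Y, let K₁ : W → W be linear, let h : V × V → W be a symmetric bilinear map, let ξ ∈ W and let c ∈ ℝ. If h(X, J₁Y) - K₁(h(X,Y)) = c·[g(X,Y)·ξ + g(X,J₁Y)·K₁ξ] for all X, Y ∈ V, then h(J₁X, J₁Y) + h(X,Y) = 2c·g(X,Y)·K₁ξ for all X, Y ∈ V. -/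
/-- if `J₁² = -id`, `g` is symmetric and Hermitian w.r.t. `J₁`, `h` is a
symmetric bilinear map and
`h(X, J₁Y) - K₁(h(X,Y)) = c·[g(X,Y)·ξ + g(X,J₁Y)·K₁ξ]` for all `X, Y`, then
`h(J₁X, J₁Y) + h(X,Y) = 2c·g(X,Y)·K₁ξ` for all `X, Y`. -/
theorem stmt7 {V W : Type*} [AddCommGroup V] [Module ℝ V] [AddCommGroup W] [Module ℝ W]
    (J₁ : V →ₗ[ℝ] V) (hJ : ∀ X : V, J₁ (J₁ X) = -X)
    (g : V →ₗ[ℝ] V →ₗ[ℝ] ℝ)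
    (hgsymm : ∀ X Y : V, g X Y = g Y X)
    (hg1 : ∀ X Y : V, g (J₁ X) (J₁ Y) = g X Y)
    (K₁ : W →ₗ[ℝ] W)
    (h : V →ₗ[ℝ] V →ₗ[ℝ] W)
    (hhsymm : ∀ X Y : V, h X Y = h Y X)
    (ξ : W) (c : ℝ)
    (hmain : ∀ X Y : V,
      h X (J₁ Y) - K₁ (h X Y) = c • (g X Y • ξ + g X (J₁ Y) • K₁ ξ)) :
    ∀ X Y : V, h (J₁ X) (J₁ Y) + h X Y = (2 * c) • (g X Y • K₁ ξ) := by
  have hskew : ∀ X Y : V, g (J₁ X) Y = -g X (J₁ Y) := fun X Y => by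
    have := hg1 X (J₁ Y)
    rw [hJ, map_neg] at this
    linarith
  have key : ∀ X Y : V, h (J₁ X) (J₁ Y) + h X Y =
      (2 * c) • (g X Y • K₁ ξ) - (2 * c * g X (J₁ Y)) • (K₁ (K₁ ξ) + ξ) := fun X Y => by
    have e₁ := hmain (J₁ X) Y
    have e₂ := hmain Y X
    have e₃ := hmain X (J₁ Y)
    have e₄ := hmain X Y
    rw [hhsymm Y (J₁ X), hhsymm Y X, hgsymm Y X, hgsymm Y (J₁ X), hskew,
      sub_eq_iff_eq_add] at e₂
    rw [sub_eq_iff_eq_add] at e₄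
    rw [hg1, hskew, e₂] at e₁
    rw [hJ, map_neg, map_neg, e₄] at e₃
    simp only [map_add, map_smul] at e₁ e₃
    linear_combination (norm := module) e₁ - e₃
  intro X Y
  have hXY := key X Y
  have hYX := key Y X
  rw [hhsymm (J₁ Y) (J₁ X), hhsymm Y X, hgsymm Y X, hgsymm Y (J₁ X), hskew] at hYX
  linear_combination (norm := module) (1 / 2 : ℝ) • hXY + (1 / 2 : ℝ) • hYX
end

section
/- Let V and W be real vector spaces, let J : V → V be linear with J∘J = -id, let g be a symmetric bilinear form on V with g(JX,JY) = -g(X,Y) for all X,Y (a Norden metric), let K : W → W be linear, let h : V × V → W be a symmetric bilinear map, let ζ ∈ W and let c ∈ ℝ. If h(X, JY) - K(h(X,Y)) = c·[g(X,Y)·ζ + g(X,JY)·Kζ] for all X, Y ∈ V, then h(X, JY) = h(JX, Y) and h(JX, JY) = -h(X,Y) for all X, Y ∈ V. -/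
/-- if `J² = -id`, `g` is a symmetric Norden form w.r.t. `J`, `h` is a
symmetric bilinear map and
`h(X, JY) - K(h(X,Y)) = c·[g(X,Y)·ζ + g(X,JY)·Kζ]` for all `X, Y`, then
`h(X, JY) = h(JX, Y)` and `h(JX, JY) = -h(X,Y)` for all `X, Y`. -/
theorem stmt8 {V W : Type*} [AddCommGroup V] [Module ℝ V] [AddCommGroup W] [Module ℝ W]
    (J : V →ₗ[ℝ] V) (hJ : ∀ X : V, J (J X) = -X)
    (g : V →ₗ[ℝ] V →ₗ[ℝ] ℝ)
    (hgsymm : ∀ X Y : V, g X Y = g Y X)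
    (hgN : ∀ X Y : V, g (J X) (J Y) = -(g X Y))
    (K : W →ₗ[ℝ] W)
    (h : V →ₗ[ℝ] V →ₗ[ℝ] W)
    (hhsymm : ∀ X Y : V, h X Y = h Y X)
    (ζ : W) (c : ℝ)
    (hmain : ∀ X Y : V,
      h X (J Y) - K (h X Y) = c • (g X Y • ζ + g X (J Y) • K ζ)) :
    (∀ X Y : V, h X (J Y) = h (J X) Y) ∧
    (∀ X Y : V, h (J X) (J Y) = -(h X Y)) := by
  have hgJ (X Y : V) : g X (J Y) = g Y (J X) := by
    have hN := hgN X (J Y)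
    rw [hJ, map_neg, neg_inj] at hN
    rw [← hN, hgsymm]
  have hhJ (X Y : V) : h X (J Y) = h (J X) Y := by
    have hYX := hmain Y X
    rw [hgsymm Y X, ← hgJ X Y, hhsymm Y X, ← hmain X Y, sub_left_inj] at hYX
    rw [← hYX, hhsymm]
  refine ⟨hhJ, fun X Y => ?_⟩
  rw [← hhJ, hJ, map_neg]
end

section
/- Let n ≥ 1, let V and W be real vector spaces each equipped with an almost hypercomplex structure, (J₁,J₂,J₃) on V and (K₁,K₂,K₃) on W, and let g be a symmetric bilinear form on V satisfying g(J₁X,J₁Y) = g(X,Y) and g(J₂X,J₂Y) = g(J₃X,J₃Y) = -g(X,Y). Let h : V × V → W be a symmetric bilinear map and let ξ₁, ξ₂, ξ₃ ∈ W satisfy K_α ξ_α = (2n/(2n-1))·K₁ξ₁ for α = 2,3. Assume that for all X,Y ∈ V: h(X,J₁Y) - K₁(h(X,Y)) = (1/(2(2n-1)))·[g(X,Y)·ξ₁ + g(X,J₁Y)·K₁ξ₁], and h(X,J_αY) - K_α(h(X,Y)) = (1/(4n))·[g(X,Y)·ξ_α + g(X,J_αY)·K_αξ_α] for α = 2,3.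 Then h(X,Y) = (1/(2(2n-1)))·g(X,Y)·K₁ξ₁ = (1/(4n))·g(X,Y)·K_αξ_α for all X,Y ∈ V and α = 2,3. -/
/-- An almost hypercomplex structure on a real vector space: a triple of linear
endomorphisms `(J₁, J₂, J₃)` with `Jα ∘ Jα = -id` and the quaternionic relations. -/
def IsAlmostHypercomplex {V : Type*} [AddCommGroup V] [Module ℝ V]
    (J₁ J₂ J₃ : V →ₗ[ℝ] V) : Prop :=
  (J₁ ∘ₗ J₁ = -LinearMap.id) ∧ (J₂ ∘ₗ J₂ = -LinearMap.id) ∧ (J₃ ∘ₗ J₃ = -LinearMap.id) ∧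
  (J₁ = J₂ ∘ₗ J₃) ∧ (J₁ = -(J₃ ∘ₗ J₂)) ∧
  (J₂ = J₃ ∘ₗ J₁) ∧ (J₂ = -(J₁ ∘ₗ J₃)) ∧
  (J₃ = J₁ ∘ₗ J₂) ∧ (J₃ = -(J₂ ∘ₗ J₁))

/-- If `h` fails to commute with a pair of complex structures `J`, `K` by the tensor
`c (g ⊗ ξ + g(·, J ·) ⊗ K ξ)`, then `h - g ⊗ (c K ξ)` commutes with them. -/
theorem apply_sub_smul_of_apply_comp {V W : Type*} [AddCommGroup V] [Module ℝ V]
    [AddCommGroup W] [Module ℝ W] {J : V →ₗ[ℝ] V} {K : W →ₗ[ℝ] W}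
    (hK : K ∘ₗ K = -LinearMap.id) {g : V →ₗ[ℝ] V →ₗ[ℝ] ℝ} {h : V →ₗ[ℝ] V →ₗ[ℝ] W}
    {c : ℝ} {ξ ζ : W} (hζ : c • K ξ = ζ)
    (hJ : ∀ X Y : V, h X (J Y) - K (h X Y) = c • (g X Y • ξ + g X (J Y) • K ξ)) (X Y : V) :
    h X (J Y) - g X (J Y) • ζ = K (h X Y - g X Y • ζ) := by
  have hKξ : K (K ξ) = -ξ := by simpa using LinearMap.congr_fun hK ξ
  rw [eq_add_of_sub_eq (hJ X Y), ← hζ]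
  simp only [map_sub, map_smul, hKξ]
  module

/-- A symmetric map that is linear over two anticommuting complex structures vanishes. -/
theorem eq_zero_of_symm_of_apply_comp {V W : Type*} [AddCommGroup V] [Module ℝ V]
    [AddCommGroup W] [Module ℝ W] {J₁ J₂ : V →ₗ[ℝ] V} {K₁ K₂ : W →ₗ[ℝ] W}
    (hK₁ : K₁ ∘ₗ K₁ = -LinearMap.id) (hK₂ : K₂ ∘ₗ K₂ = -LinearMap.id)
    (hK : K₁ ∘ₗ K₂ = -(K₂ ∘ₗ K₁)) {T : V → V → W} (hT : ∀ X Y, T X Y = T Y X)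
    (h₁ : ∀ X Y, T X (J₁ Y) = K₁ (T X Y)) (h₂ : ∀ X Y, T X (J₂ Y) = K₂ (T X Y)) (X Y : V) :
    T X Y = 0 := by
  have hcomm : K₁ (K₂ (T X Y)) = K₂ (K₁ (T X Y)) := by
    calc
      K₁ (K₂ (T X Y)) = T (J₂ Y) (J₁ X) := by rw [h₁, hT (J₂ Y), h₂]
      _ = K₂ (K₁ (T X Y)) := by rw [hT, h₂, hT (J₁ X), h₁, hT Y]
  have hanti : K₁ (K₂ (T X Y)) = -K₂ (K₁ (T X Y)) := by
    simpa using LinearMap.congr_fun hK (T X Y)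
  have : IsAddTorsionFree W := .of_isTorsionFree ℝ W
  have hzero : K₂ (K₁ (T X Y)) = 0 := self_eq_neg.mp (hcomm.symm.trans hanti)
  have hinj : ∀ {K : W →ₗ[ℝ] W}, K ∘ₗ K = -LinearMap.id → ∀ w, K w = 0 → w = 0 := by
    intro K hKK w hw
    simpa [hw] using LinearMap.congr_fun hKK w
  exact hinj hK₁ _ (hinj hK₂ _ hzero)

/-- the algebraic core of Theorem 3.1 (formula (3.8)): under the
hypotheses (3.17), (3.18) and the normal component of (3.3), the second fundamental
form satisfies `h(X,Y) = (1/(2(2n-1)))·g(X,Y)·K₁ξ₁ = (1/(4n))·g(X,Y)·K_αξ_α`. -/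
theorem stmt9 (n : ℕ) (hn : 1 ≤ n)
    {V W : Type*} [AddCommGroup V] [Module ℝ V] [AddCommGroup W] [Module ℝ W]
    (J₁ J₂ J₃ : V →ₗ[ℝ] V) (hHV : IsAlmostHypercomplex J₁ J₂ J₃)
    (K₁ K₂ K₃ : W →ₗ[ℝ] W) (hHW : IsAlmostHypercomplex K₁ K₂ K₃)
    (g : V →ₗ[ℝ] V →ₗ[ℝ] ℝ)
    (hgsymm : ∀ X Y : V, g X Y = g Y X)
    (hg1 : ∀ X Y : V, g (J₁ X) (J₁ Y) = g X Y)
    (hg2 : ∀ X Y : V, g (J₂ X) (J₂ Y) = -(g X Y))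
    (hg3 : ∀ X Y : V, g (J₃ X) (J₃ Y) = -(g X Y))
    (h : V →ₗ[ℝ] V →ₗ[ℝ] W)
    (hhsymm : ∀ X Y : V, h X Y = h Y X)
    (ξ₁ ξ₂ ξ₃ : W)
    (hξ2 : K₂ ξ₂ = ((2 * n : ℝ) / (2 * n - 1)) • K₁ ξ₁)
    (hξ3 : K₃ ξ₃ = ((2 * n : ℝ) / (2 * n - 1)) • K₁ ξ₁)
    (hmain1 : ∀ X Y : V, h X (J₁ Y) - K₁ (h X Y) =
      (1 / (2 * (2 * n - 1) : ℝ)) • (g X Y • ξ₁ + g X (J₁ Y) • K₁ ξ₁))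
    (hmain2 : ∀ X Y : V, h X (J₂ Y) - K₂ (h X Y) =
      (1 / (4 * n : ℝ)) • (g X Y • ξ₂ + g X (J₂ Y) • K₂ ξ₂))
    (hmain3 : ∀ X Y : V, h X (J₃ Y) - K₃ (h X Y) =
      (1 / (4 * n : ℝ)) • (g X Y • ξ₃ + g X (J₃ Y) • K₃ ξ₃)) :
    ∀ X Y : V,
      h X Y = (1 / (2 * (2 * n - 1) : ℝ)) • (g X Y • K₁ ξ₁) ∧
      h X Y = (1 / (4 * n : ℝ)) • (g X Y • K₂ ξ₂) ∧
      h X Y = (1 / (4 * n : ℝ)) • (g X Y • K₃ ξ₃) := by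
  have hn' : (1 : ℝ) ≤ n := by exact_mod_cast hn
  have hn0 : (n : ℝ) ≠ 0 := by positivity
  have hn1 : (2 * n - 1 : ℝ) ≠ 0 := by linarith
  have hc : (1 / (4 * n) : ℝ) * (2 * n / (2 * n - 1)) = 1 / (2 * (2 * n - 1)) := by
    field_simp
    norm_num
  obtain ⟨hK₁, hK₂, -, -, -, -, -, hK₃, hK₃'⟩ := hHW
  set ζ : W := (1 / (2 * (2 * n - 1)) : ℝ) • K₁ ξ₁ with hζ
  have hζ₂ : (1 / (4 * n) : ℝ) • K₂ ξ₂ = ζ := by rw [hξ2, smul_smul, hc]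
  have hζ₃ : (1 / (4 * n) : ℝ) • K₃ ξ₃ = ζ := by rw [hξ3, smul_smul, hc]
  -- Subtracting `g ⊗ ζ` from `h` leaves a symmetric tensor that is quaternionic-linear.
  have h₁ := apply_sub_smul_of_apply_comp hK₁ hζ.symm hmain1
  have h₂ := apply_sub_smul_of_apply_comp hK₂ hζ₂ hmain2
  have hT : ∀ X Y : V, h X Y = g X Y • ζ := fun X Y =>
    sub_eq_zero.mp <| eq_zero_of_symm_of_apply_comp hK₁ hK₂ (hK₃.symm.trans hK₃')
      (T := fun X Y => h X Y - g X Y • ζ)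
      (fun X Y => by rw [hhsymm, hgsymm]) h₁ h₂ X Y
  intro X Y
  refine ⟨?_, ?_, ?_⟩
  · rw [hT, smul_comm _ (g X Y)]
  · rw [hT, smul_comm _ (g X Y), hζ₂]
  · rw [hT, smul_comm _ (g X Y), hζ₃]
end

section
/- Let n ≥ 1, let V and W be real vector spaces each equipped with an almost hypercomplex structure, (J₁,J₂,J₃) on V and (K₁,K₂,K₃) on W, let g be a nonzero symmetric bilinear form on V satisfying g(J₁X,J₁Y) = g(X,Y) and g(J₂X,J₂Y) = g(J₃X,J₃Y) = -g(X,Y), let h : V × V → W be a symmetric bilinear map, and let ξ₁, ξ₂, ξ₃ ∈ W satisfy K_α ξ_α = (2n/(2n-1))·K₁ξ₁ (α = 2,3) together with equations h(X,J₁Y) - K₁(h(X,Y)) = (1/(2(2n-1)))·[g(X,Y)·ξ₁ + g(X,J₁Y)·K₁ξ₁] and h(X,J_αY) - K_α(h(X,Y)) = (1/(4n))·[g(X,Y)·ξ_α + g(X,J_αY)·K_αξ_α] for α = 2,3 and all X,Y ∈ V. Set C = (1/(2(2n-1)))·K₁ξ₁. Then h(X,Y) = g(X,Y)·C for all X,Y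 ∈ V, and h ≡ 0 if and only if ξ₁ = 0, if and only if ξ₁ = ξ₂ = ξ₃ = 0; hence h is either identically zero or everywhere of the totally umbilical form g(X,Y)·C with C ≠ 0. -/
theorem LinearMap.apply_apply_self_of_comp_self_eq_neg_id {R M : Type*} [Ring R]
    [AddCommGroup M] [Module R M] {K : M →ₗ[R] M} (hK : K ∘ₗ K = -LinearMap.id) (w : M) :
    K (K w) = -w := by
  simpa using LinearMap.congr_fun hK w

/-- A symmetric map which, in its second argument, intertwines two maps `J₁, J₂` with the first
two members of an almost hypercomplex structure vanishes. -/
theorem IsAlmostHypercomplex.eq_zero_of_symm_of_intertwines {V W : Type*}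
    [AddCommGroup W] [Module ℝ W] {K₁ K₂ K₃ : W →ₗ[ℝ] W}
    (hK : IsAlmostHypercomplex K₁ K₂ K₃) {J₁ J₂ : V → V} {D : V → V → W}
    (hsymm : ∀ X Y, D X Y = D Y X)
    (h₁ : ∀ X Y, D X (J₁ Y) = K₁ (D X Y)) (h₂ : ∀ X Y, D X (J₂ Y) = K₂ (D X Y)) (X Y : V) :
    D X Y = 0 := by
  obtain ⟨-, -, hK₃, -, -, -, -, h12, h21⟩ := hK
  have hcomm : K₁ (K₂ (D X Y)) = K₂ (K₁ (D X Y)) := by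
    rw [← h₂, hsymm, ← h₁, hsymm, h₂, hsymm, h₁, hsymm]
  have e12 : K₃ (D X Y) = K₁ (K₂ (D X Y)) := by simpa using LinearMap.congr_fun h12 (D X Y)
  have e21 : K₃ (D X Y) = -K₂ (K₁ (D X Y)) := by simpa using LinearMap.congr_fun h21 (D X Y)
  have hzero : K₃ (D X Y) = 0 := by
    rw [← hcomm, ← e12] at e21
    have : IsAddTorsionFree W := .of_isTorsionFree ℝ W
    exact self_eq_neg.mp e21
  have hsq := LinearMap.apply_apply_self_of_comp_self_eq_neg_id hK₃ (D X Y)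
  rw [hzero, map_zero] at hsq
  exact neg_eq_zero.mp hsq.symm

/-- the algebraic core of Theorem 3.3: with `C = (1/(2(2n-1)))·K₁ξ₁`
the mean curvature vector, `h(X,Y) = g(X,Y)·C`, and `h ≡ 0` iff `ξ₁ = 0` iff
`ξ₁ = ξ₂ = ξ₃ = 0`; hence `h` is either identically zero (totally geodesic) or of
the totally umbilical form `g(X,Y)·C` with `C ≠ 0`. -/
theorem stmt10 (n : ℕ) (hn : 1 ≤ n)
    {V W : Type*} [AddCommGroup V] [Module ℝ V] [AddCommGroup W] [Module ℝ W]
    (J₁ J₂ J₃ : V →ₗ[ℝ] V) (hHV : IsAlmostHypercomplex J₁ J₂ J₃)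
    (K₁ K₂ K₃ : W →ₗ[ℝ] W) (hHW : IsAlmostHypercomplex K₁ K₂ K₃)
    (g : V →ₗ[ℝ] V →ₗ[ℝ] ℝ) (hg0 : g ≠ 0)
    (hgsymm : ∀ X Y : V, g X Y = g Y X)
    (hg1 : ∀ X Y : V, g (J₁ X) (J₁ Y) = g X Y)
    (hg2 : ∀ X Y : V, g (J₂ X) (J₂ Y) = -(g X Y))
    (hg3 : ∀ X Y : V, g (J₃ X) (J₃ Y) = -(g X Y))
    (h : V →ₗ[ℝ] V →ₗ[ℝ] W)
    (hhsymm : ∀ X Y : V, h X Y = h Y X)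
    (ξ₁ ξ₂ ξ₃ : W)
    (hξ2 : K₂ ξ₂ = ((2 * n : ℝ) / (2 * n - 1)) • K₁ ξ₁)
    (hξ3 : K₃ ξ₃ = ((2 * n : ℝ) / (2 * n - 1)) • K₁ ξ₁)
    (hmain1 : ∀ X Y : V, h X (J₁ Y) - K₁ (h X Y) =
      (1 / (2 * (2 * n - 1) : ℝ)) • (g X Y • ξ₁ + g X (J₁ Y) • K₁ ξ₁))
    (hmain2 : ∀ X Y : V, h X (J₂ Y) - K₂ (h X Y) =
      (1 / (4 * n : ℝ)) • (g X Y • ξ₂ + g X (J₂ Y) • K₂ ξ₂))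
    (hmain3 : ∀ X Y : V, h X (J₃ Y) - K₃ (h X Y) =
      (1 / (4 * n : ℝ)) • (g X Y • ξ₃ + g X (J₃ Y) • K₃ ξ₃)) :
    (∀ X Y : V, h X Y = g X Y • ((1 / (2 * (2 * n - 1) : ℝ)) • K₁ ξ₁)) ∧
    ((∀ X Y : V, h X Y = 0) ↔ ξ₁ = 0) ∧
    ((ξ₁ = 0) ↔ (ξ₁ = 0 ∧ ξ₂ = 0 ∧ ξ₃ = 0)) ∧
    ((∀ X Y : V, h X Y = 0) ∨ (1 / (2 * (2 * n - 1) : ℝ)) • K₁ ξ₁ ≠ 0) := by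
  have hn' : (1 : ℝ) ≤ n := by exact_mod_cast hn
  have hm : (2 * n - 1 : ℝ) ≠ 0 := by linarith
  have hn0 : (n : ℝ) ≠ 0 := by linarith
  have hK₁ := LinearMap.apply_apply_self_of_comp_self_eq_neg_id hHW.1
  have hK₂ := LinearMap.apply_apply_self_of_comp_self_eq_neg_id hHW.2.1
  have hK₃ := LinearMap.apply_apply_self_of_comp_self_eq_neg_id hHW.2.2.1
  have hc : (1 / (2 * (2 * n - 1)) : ℝ) ≠ 0 := by simpa using hm
  obtain ⟨C, hC⟩ : ∃ C, C = (1 / (2 * (2 * n - 1) : ℝ)) • K₁ ξ₁ := ⟨_, rfl⟩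
  have hC₁ : (1 / (2 * (2 * n - 1) : ℝ)) • ξ₁ = -K₁ C := by
    rw [hC, map_smul, hK₁, smul_neg, neg_neg]
  have hCξ₂ : (1 / (4 * n : ℝ)) • K₂ ξ₂ = C := by
    rw [hC, hξ2, smul_smul]
    congr 1
    field_simp
    norm_num
  have hC₂ : (1 / (4 * n : ℝ)) • ξ₂ = -K₂ C := by
    rw [← hCξ₂, map_smul, hK₂, smul_neg, neg_neg]
  have hC_iff : C = 0 ↔ ξ₁ = 0 := by
    refine ⟨fun hC0 => ?_, fun hξ => by rw [hC, hξ, map_zero, smul_zero]⟩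
    rw [hC0, map_zero, neg_zero] at hC₁
    exact (smul_eq_zero.mp hC₁).resolve_left hc
  have humbilical : ∀ X Y : V, h X Y = g X Y • C := by
    intro X Y
    refine sub_eq_zero.mp (hHW.eq_zero_of_symm_of_intertwines (J₁ := J₁) (J₂ := J₂)
      (D := fun X Y => h X Y - g X Y • C) (fun X Y => by rw [hhsymm, hgsymm]) ?_ ?_ X Y)
    · intro X Y
      have e := hmain1 X Y
      rw [smul_add, smul_comm _ (g X Y), smul_comm _ (g X (J₁ Y)), hC₁, ← hC,
        sub_eq_iff_eq_add] at e
      simp only [e, map_sub, map_smul]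
      module
    · intro X Y
      have e := hmain2 X Y
      rw [smul_add, smul_comm _ (g X Y), smul_comm _ (g X (J₂ Y)), hC₂, hCξ₂,
        sub_eq_iff_eq_add] at e
      simp only [e, map_sub, map_smul]
      module
  have hgeodesic : (∀ X Y : V, h X Y = 0) ↔ C = 0 := by
    refine ⟨fun hh => ?_, fun hC0 X Y => by rw [humbilical, hC0, smul_zero]⟩
    by_contra hC0
    refine hg0 (LinearMap.ext₂ fun X Y => ?_)
    have e := humbilical X Y
    rw [hh] at e
    exact (smul_eq_zero.mp e.symm).resolve_right hC0
  rw [← hC]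
  refine ⟨humbilical, hgeodesic.trans hC_iff, ⟨fun hξ => ⟨hξ, ?_, ?_⟩, And.left⟩,
    (em (C = 0)).imp hgeodesic.mpr id⟩
  · have e := hK₂ ξ₂
    rw [hξ2, hξ, map_zero, smul_zero, map_zero] at e
    exact neg_eq_zero.mp e.symm
  · have e := hK₃ ξ₃
    rw [hξ3, hξ, map_zero, smul_zero, map_zero] at e
    exact neg_eq_zero.mp e.symm
end

section
/- Let n > m ≥ 1, let U be a real vector space of dimension 4m with a nondegenerate symmetric bilinear form g and endomorphisms J₁ (with J₁² = -id, g(J₁X,J₁Y) = g(X,Y)) and J_α for α = 2,3 (with J_α² = -id, g(J_αX,J_αY) = -g(X,Y)). Let τ₁, τ₂, τ₃ be linear functionals on U, and define F₁(X,Y,Z) = (1/(2(2n-1)))·[g(X,Y)τ₁(Z) - g(X,Z)τ₁(Y) - g(X,J₁Y)τ₁(J₁Z) + g(X,J₁Z)τ₁(J₁Y)] and F_α(X,Y,Z) = (1/(4n))·[g(X,Y)τ_α(Z) + g(X,Z)τ_α(Y) + g(X,J_αY)τ_α(J_αZ) + g(X,J_αZ)τ_α(J_αY)] for α = 2,3.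 Then the Lee forms θ_α(Z) = Σ_i F_α(e_i, f_i, Z) (for a basis {e_i} of U with g-dual basis {f_i}) satisfy θ₁ = ((2m-1)/(2n-1))·τ₁ and θ_α = (m/n)·τ_α for α = 2,3. -/
/-- A real square matrix squaring to `-1` has trace zero. -/
theorem Matrix.trace_eq_zero_of_mul_self_eq_neg_one {ι : Type*} [Fintype ι] [DecidableEq ι]
    (A : Matrix ι ι ℝ) (hA : A * A = -1) : A.trace = 0 := by
  set B : Matrix ι ι ℂ := A.map Complex.ofRealHom with hB
  have hBB : B * B = -1 := by
    rw [hB, ← Matrix.map_mul, hA]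
    ext i j
    by_cases h : i = j <;> simp [h]
  set P : Matrix ι ι ℂ := (1 / 2 : ℂ) • (1 - Complex.I • B) with hP
  have hPP : IsIdempotentElem P := by
    have hI : (Complex.I • B) * (Complex.I • B) = 1 := by
      rw [smul_mul_smul_comm, hBB, Complex.I_mul_I]
      simp
    have hsq : (1 - Complex.I • B) * (1 - Complex.I • B) = (2 : ℂ) • (1 - Complex.I • B) := by
      rw [sub_mul, mul_sub, mul_sub, hI, two_smul]
      simp only [one_mul, mul_one]
      abel
    rw [IsIdempotentElem, hP, smul_mul_smul_comm, hsq, smul_smul]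
    norm_num
  have hlin : IsIdempotentElem (Matrix.toLin' P) := by
    rw [IsIdempotentElem, Module.End.mul_eq_comp, ← Matrix.toLin'_mul, hPP.eq]
  have htr := (LinearMap.IsIdempotentElem.isProj_range _ hlin).trace
  rw [Matrix.trace_toLin'_eq] at htr
  have hBtr : B.trace = (A.trace : ℂ) := by
    simp [hB, Matrix.trace]
  have him := congrArg Complex.im htr
  rw [hP, Matrix.trace_smul, Matrix.trace_sub, Matrix.trace_smul, hBtr] at him
  simpa using him

/-- A real endomorphism squaring to `-id` has trace zero. -/
theorem LinearMap.trace_eq_zero_of_apply_apply_eq_neg {U ι : Type*} [AddCommGroup U] [Module ℝ U]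
    [Fintype ι] [DecidableEq ι] (b : Module.Basis ι ℝ U) (J : U →ₗ[ℝ] U)
    (hJ : ∀ X, J (J X) = -X) : LinearMap.trace ℝ U J = 0 := by
  rw [LinearMap.trace_eq_matrix_trace ℝ b]
  apply Matrix.trace_eq_zero_of_mul_self_eq_neg_one
  rw [← LinearMap.toMatrix_comp, show J ∘ₗ J = -LinearMap.id from LinearMap.ext hJ, map_neg,
    LinearMap.toMatrix_id]

section DualBasis

variable {U ι : Type*} [AddCommGroup U] [Module ℝ U] [Fintype ι] [DecidableEq ι]

/-- The coordinates of a vector in a basis are its pairings with the dual family. -/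
theorem Module.Basis.repr_eq_of_dual (b : Module.Basis ι ℝ U) (g : U →ₗ[ℝ] U →ₗ[ℝ] ℝ) (f : ι → U)
    (hbf : ∀ i j, g (b i) (f j) = if i = j then 1 else 0) (X : U) (i : ι) :
    b.repr X i = g X (f i) := by
  conv_rhs => rw [← b.sum_repr X]
  simp [hbf, -Module.Basis.sum_repr]

/-- A bilinear form nondegenerate on the left and symmetric expands vectors in the dual family. -/
theorem sum_smul_dual_eq (b : Module.Basis ι ℝ U) (g : U →ₗ[ℝ] U →ₗ[ℝ] ℝ)
    (hgsymm : ∀ X Y : U, g X Y = g Y X)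
    (hgnd : ∀ X : U, (∀ Y : U, g X Y = 0) → X = 0) (f : ι → U)
    (hbf : ∀ i j, g (b i) (f j) = if i = j then 1 else 0) (Z : U) :
    ∑ i, g (b i) Z • f i = Z := by
  rw [← sub_eq_zero]
  apply hgnd
  intro Y
  rw [hgsymm]
  suffices h : g.flip (∑ i, g (b i) Z • f i - Z) = 0 from LinearMap.congr_fun h Y
  apply b.ext
  intro j
  simp [hbf]

theorem sum_apply_mul_dual (b : Module.Basis ι ℝ U) (g : U →ₗ[ℝ] U →ₗ[ℝ] ℝ)
    (hgsymm : ∀ X Y : U, g X Y = g Y X)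
    (hgnd : ∀ X : U, (∀ Y : U, g X Y = 0) → X = 0) (f : ι → U)
    (hbf : ∀ i j, g (b i) (f j) = if i = j then 1 else 0) (φ : U →ₗ[ℝ] ℝ) (Z : U) :
    ∑ i, g (b i) Z * φ (f i) = φ Z := by
  conv_rhs => rw [← sum_smul_dual_eq b g hgsymm hgnd f hbf Z]
  simp

/-- The trace of an endomorphism squaring to `-id` vanishes when computed with dual bases,
for an isometry or an anti-isometry of `g`. -/
theorem sum_apply_dual_eq_zero (b : Module.Basis ι ℝ U) (g : U →ₗ[ℝ] U →ₗ[ℝ] ℝ) (f : ι → U)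
    (hbf : ∀ i j, g (b i) (f j) = if i = j then 1 else 0) (J : U →ₗ[ℝ] U)
    (hJ : ∀ X, J (J X) = -X) (ε : ℝ) (hg : ∀ X Y, g (J X) (J Y) = ε * g X Y) :
    ∑ i, g (b i) (J (f i)) = 0 := by
  have htr := LinearMap.trace_eq_zero_of_apply_apply_eq_neg b J hJ
  rw [LinearMap.trace_eq_matrix_trace ℝ b, Matrix.trace] at htr
  simp only [Matrix.diag_apply, LinearMap.toMatrix_apply, b.repr_eq_of_dual g f hbf] at htr
  have key : ∀ i, g (b i) (J (f i)) = -(ε * g (J (b i)) (f i)) := fun i => by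
    have h := hg (J (b i)) (f i)
    rw [hJ, map_neg, LinearMap.neg_apply] at h
    linarith
  rw [Finset.sum_congr rfl fun i _ => key i, Finset.sum_neg_distrib, ← Finset.mul_sum, htr]
  simp

end DualBasis

/-- formula (3.29) of the paper: for a `4m`-dimensional tangent space
`U` of a holomorphic submanifold of a `4n`-dimensional W-manifold, the Lee forms
obtained by contracting the fundamental tensors (3.28) satisfy
`θ₁ = ((2m-1)/(2n-1))·τ₁` and `θ_α = (m/n)·τ_α` for `α = 2,3`. -/
theorem stmt13 (n m : ℕ) (hm : 1 ≤ m) (hmn : m < n)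
    {U : Type*} [AddCommGroup U] [Module ℝ U]
    (hdim : Module.finrank ℝ U = 4 * m)
    (g : U →ₗ[ℝ] U →ₗ[ℝ] ℝ)
    (hgsymm : ∀ X Y : U, g X Y = g Y X)
    (hgnd : ∀ X : U, (∀ Y : U, g X Y = 0) → X = 0)
    (J₁ J₂ J₃ : U →ₗ[ℝ] U)
    (hJ1 : ∀ X : U, J₁ (J₁ X) = -X)
    (hJ2 : ∀ X : U, J₂ (J₂ X) = -X)
    (hJ3 : ∀ X : U, J₃ (J₃ X) = -X)
    (hg1 : ∀ X Y : U, g (J₁ X) (J₁ Y) = g X Y)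
    (hg2 : ∀ X Y : U, g (J₂ X) (J₂ Y) = -(g X Y))
    (hg3 : ∀ X Y : U, g (J₃ X) (J₃ Y) = -(g X Y))
    (τ₁ τ₂ τ₃ : U →ₗ[ℝ] ℝ)
    (F₁ F₂ F₃ : U → U → U → ℝ)
    (hF1 : ∀ X Y Z : U, F₁ X Y Z = (1 / (2 * (2 * n - 1) : ℝ)) *
      (g X Y * τ₁ Z - g X Z * τ₁ Y - g X (J₁ Y) * τ₁ (J₁ Z) + g X (J₁ Z) * τ₁ (J₁ Y)))
    (hF2 : ∀ X Y Z : U, F₂ X Y Z = (1 / (4 * n : ℝ)) *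
      (g X Y * τ₂ Z + g X Z * τ₂ Y + g X (J₂ Y) * τ₂ (J₂ Z) + g X (J₂ Z) * τ₂ (J₂ Y)))
    (hF3 : ∀ X Y Z : U, F₃ X Y Z = (1 / (4 * n : ℝ)) *
      (g X Y * τ₃ Z + g X Z * τ₃ Y + g X (J₃ Y) * τ₃ (J₃ Z) + g X (J₃ Z) * τ₃ (J₃ Y)))
    (e f : Fin (4 * m) → U) (he : ∀ i j, g (e i) (f j) = if i = j then 1 else 0)
    (hbasis : LinearIndependent ℝ e ∧ Submodule.span ℝ (Set.range e) = ⊤) :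
    (∀ Z : U, ∑ i, F₁ (e i) (f i) Z = ((2 * m - 1 : ℝ) / (2 * n - 1)) * τ₁ Z) ∧
    (∀ Z : U, ∑ i, F₂ (e i) (f i) Z = ((m : ℝ) / n) * τ₂ Z) ∧
    (∀ Z : U, ∑ i, F₃ (e i) (f i) Z = ((m : ℝ) / n) * τ₃ Z) := by
  set b : Module.Basis (Fin (4 * m)) ℝ U := Module.Basis.mk hbasis.1 hbasis.2.ge with hb
  have hbe : ∀ i, b i = e i := fun i => by rw [hb, Module.Basis.mk_apply]
  have hbf : ∀ i j, g (b i) (f j) = if i = j then 1 else 0 := fun i j => by rw [hbe, he]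
  have hid : ∑ i, g (e i) (f i) = 4 * m := by simp [he]
  have hsum : ∀ (φ : U →ₗ[ℝ] ℝ) (Z : U), ∑ i, g (e i) Z * φ (f i) = φ Z := fun φ Z => by
    simpa only [hbe] using sum_apply_mul_dual b g hgsymm hgnd f hbf φ Z
  have htr : ∀ (J : U →ₗ[ℝ] U), (∀ X, J (J X) = -X) → ∀ ε : ℝ,
      (∀ X Y, g (J X) (J Y) = ε * g X Y) → ∑ i, g (e i) (J (f i)) = 0 := fun J hJ ε hg => by
    simpa only [hbe] using sum_apply_dual_eq_zero b g f hbf J hJ ε hg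
  have hlast : ∀ (J : U →ₗ[ℝ] U), (∀ X, J (J X) = -X) → ∀ (τ : U →ₗ[ℝ] ℝ) (Z : U),
      ∑ i, g (e i) (J Z) * τ (J (f i)) = -τ Z := fun J hJ τ Z => by
    simpa [hJ] using hsum (τ ∘ₗ J) (J Z)
  have hn1 : (1 : ℝ) < n := by exact_mod_cast hm.trans_lt hmn
  have hn : (n : ℝ) ≠ 0 := by linarith
  have hn' : (2 * n - 1 : ℝ) ≠ 0 := by linarith
  have hanti : ∀ (J : U →ₗ[ℝ] U), (∀ X, J (J X) = -X) → (∀ X Y, g (J X) (J Y) = -(g X Y)) →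
      ∀ (τ : U →ₗ[ℝ] ℝ) (Z : U), ∑ i, (1 / (4 * n : ℝ)) *
        (g (e i) (f i) * τ Z + g (e i) Z * τ (f i) + g (e i) (J (f i)) * τ (J Z)
          + g (e i) (J Z) * τ (J (f i))) = ((m : ℝ) / n) * τ Z := fun J hJ hg τ Z => by
    rw [← Finset.mul_sum]
    simp only [Finset.sum_add_distrib, ← Finset.sum_mul]
    rw [hid, hsum, htr J hJ (-1) (by simpa using hg), hlast J hJ]
    field_simp
    ring
  refine ⟨fun Z => ?_, fun Z => ?_, fun Z => ?_⟩
  · simp only [hF1]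
    rw [← Finset.mul_sum]
    simp only [Finset.sum_add_distrib, Finset.sum_sub_distrib, ← Finset.sum_mul]
    rw [hid, hsum, htr J₁ hJ1 1 (by simpa using hg1), hlast J₁ hJ1]
    field_simp
    ring
  · simp only [hF2]
    exact hanti J₂ hJ2 hg2 τ₂ Z
  · simp only [hF3]
    exact hanti J₃ hJ3 hg3 τ₃ Z
end
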